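/- arXiv:2303.17278 — 2 statements merged into one kernel-verified Lean document; each statement's English description precedes it below -/
import Mathlib

section
/- Let A be a d1-dimensional k1-stochastic matrix of order n (1 ≤ k1 ≤ d1) and B be a d2-dimensional k2-stochastic matrix of order n (1 ≤ k2 ≤ d2), and set r = max{k1 + d2, k2 + d1}. If r ≤ d1 + d2 − 2, then n^{k1 + k2 − r − 1} · (AB) is a (d1 + d2 − 2)-dimensional r-stochastic matrix of order n. -/
open scoped BigOperators

/-- A `d`-dimensional matrix of order `n`: an array of reals indexed by `{1,…,n}^d`. -/
abbrev MDMatrix (d n : ℕ) := (Fin d → Fin n) → ℝ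

namespace MDMatrix

noncomputable section

/-- The matrix is (entrywise) nonnegative. -/
def Nonneg {d n : ℕ} (A : MDMatrix d n) : Prop := ∀ α, 0 ≤ A α

/-- `A` is `k`-stochastic: it is nonnegative and the sum of its entries over every
`k`-dimensional plane equals `1`.  A `k`-dimensional plane is specified by the set `F`
of fixed positions (with `F.card = d - k`) together with the fixed values `f` at those
positions; the sum runs over all indices agreeing with `f` on `F`. -/
def IsStochastic {d n : ℕ} (k : ℕ) (A : MDMatrix d n) : Prop :=
  Nonneg A ∧
    ∀ F : Finset (Fin d), F.card = d - k → ∀ f : Fin d → Fin n,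
      ∑ α ∈ Finset.univ.filter (fun α : Fin d → Fin n => ∀ i ∈ F, α i = f i), A α = 1

/-- The outer product `A × B`. -/
def outer {d1 d2 n : ℕ} (A : MDMatrix d1 n) (B : MDMatrix d2 n) : MDMatrix (d1 + d2) n :=
  fun γ => A (fun i => γ (Fin.castAdd d2 i)) * B (fun j => γ (Fin.natAdd d1 j))

/-- The Kronecker product `A ⊗ B`: the entry at `γ` is `a_α * b_β` where
`γ i` encodes the pair `(α i, β i)` (i.e. `γ_i = (α_i - 1)·n2 + β_i` in 1-based terms). -/
def kron {d n1 n2 : ℕ} (A : MDMatrix d n1) (B : MDMatrix d n2) : MDMatrix d (n1 * n2) :=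
  fun γ => A (fun i => (finProdFinEquiv.symm (γ i)).1) * B (fun i => (finProdFinEquiv.symm (γ i)).2)

/-- The `S`-contraction `A_S`: at index `β` it is `∑_{i=1}^n a_γ` where `γ` has all
components in positions of `S` equal to `i` and agrees with `β` (read along the
increasing enumeration of `Sᶜ`) elsewhere. -/
def contract {d n : ℕ} (A : MDMatrix d n) (S : Finset (Fin d)) {e : ℕ}
    (h : Sᶜ.card = e) : MDMatrix e n :=
  fun β => ∑ i : Fin n, A fun j =>
    if hj : j ∈ S then i
    else β ((Sᶜ.orderIsoOfFin h).symm ⟨j, Finset.mem_compl.mpr hj⟩)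

/-- The `S`-projection `P_S(A)`: at index `β` it is the sum of `a_γ` over all indices `γ`
agreeing with `β` outside of `S` (components at positions of `S` range independently). -/
def project {d n : ℕ} (A : MDMatrix d n) (S : Finset (Fin d)) {e : ℕ}
    (h : Sᶜ.card = e) : MDMatrix e n :=
  fun β => ∑ g : S → Fin n, A fun j =>
    if hj : j ∈ S then g ⟨j, hj⟩
    else β ((Sᶜ.orderIsoOfFin h).symm ⟨j, Finset.mem_compl.mpr hj⟩)

/-- The dot product `AB` of a `(e1+1)`-dimensional and a `(e2+1)`-dimensional matrix:
`(AB)_{αβ} = ∑_i a_{α i} b_{i β}`. -/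
def dot {e1 e2 n : ℕ} (A : MDMatrix (e1 + 1) n) (B : MDMatrix (e2 + 1) n) :
    MDMatrix (e1 + e2) n :=
  fun γ => ∑ i : Fin n,
    A (Fin.snoc (fun j => γ (Fin.castAdd e2 j)) i) *
      B (Fin.cons i fun j => γ (Fin.natAdd e1 j))

/-- The circle product `A ∘ B`:
`(A∘B)_{i β_2 ⋯ β_{d1}} = ∑_{j_2,…,j_{d1}} a_{i j_2 ⋯ j_{d1}} b_{j_2 β_2} ⋯ b_{j_{d1} β_{d1}}`.
The index `γ : Fin (e1*e2+1)` consists of the head `γ 0 = i` followed by `e1` blocks of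
length `e2` (block `k`, position `m` sits at `(finProdFinEquiv (k, m)).succ`). -/
def circ {e1 e2 n : ℕ} (A : MDMatrix (e1 + 1) n) (B : MDMatrix (e2 + 1) n) :
    MDMatrix (e1 * e2 + 1) n :=
  fun γ => ∑ j : Fin e1 → Fin n,
    A (Fin.cons (γ 0) j) *
      ∏ k : Fin e1, B (Fin.cons (j k) fun m => γ (finProdFinEquiv (k, m)).succ)

/-- `J_n^d`: the `d`-dimensional matrix of order `n` all of whose entries equal `1/n`. -/
def J (d n : ℕ) : MDMatrix d n := fun _ => 1 / (n : ℝ)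

/-- The permanent: `per A = ∑_{σ_2,…,σ_d ∈ S_n} ∏_{i=1}^n a_{i, σ_2(i), …, σ_d(i)}`. -/
def per {d n : ℕ} (A : MDMatrix d n) : ℝ :=
  ∑ σ : Fin (d - 1) → Equiv.Perm (Fin n), ∏ i : Fin n,
    A fun k => if h : (k : ℕ) = 0 then i
      else σ ⟨(k : ℕ) - 1, by have := k.isLt; omega⟩ i

/-- A multidimensional permutation: a `(0,1)`-matrix in which every line (the `1`-dimensional
plane obtained by varying coordinate `j` of a base index `f`) contains exactly one `1`. -/
def IsPermutationMatrix {d n : ℕ} (M : MDMatrix d n) : Prop :=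
  (∀ α, M α = 0 ∨ M α = 1) ∧
    ∀ (j : Fin d) (f : Fin d → Fin n), ∃! x : Fin n, M (Function.update f j x) = 1

end

end MDMatrix

namespace MDMatrix

/-- Sums over planes of a `k`-stochastic matrix of dimension `k + t` are `n ^ t`. -/
theorem IsStochastic.sum_plane {d n k : ℕ} {A : MDMatrix d n} (hA : IsStochastic k A) (t : ℕ) :
    ∀ (F : Finset (Fin d)) (f : Fin d → Fin n), F.card + t = d - k →
      ∑ α ∈ Finset.univ.filter (fun α : Fin d → Fin n => ∀ i ∈ F, α i = f i), A α =
        (n : ℝ) ^ t := by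
  induction t with
  | zero => intro F f hF; simpa using hA.2 F hF f
  | succ t ih =>
    intro F f hF
    obtain ⟨j, hj⟩ : ∃ j, j ∉ F := by
      by_contra! h
      have : F.card = d := by
        rw [Finset.eq_univ_iff_forall.mpr h, Finset.card_univ, Fintype.card_fin]
      omega
    have key (x : Fin n) :
        ∑ α ∈ (Finset.univ.filter (fun α : Fin d → Fin n => ∀ i ∈ F, α i = f i)).filter
          (fun α => α j = x), A α = (n : ℝ) ^ t := by
      rw [← ih (insert j F) (Function.update f j x)
        (by rw [Finset.card_insert_of_notMem hj]; omega), Finset.filter_filter]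
      refine Finset.sum_congr (Finset.filter_congr fun α _ => ?_) fun _ _ => rfl
      rw [Finset.forall_mem_insert, Function.update_self, and_comm]
      refine and_congr_right fun _ => forall₂_congr fun i hi => ?_
      rw [Function.update_of_ne (ne_of_mem_of_not_mem hi hj)]
    rw [← Finset.sum_fiberwise _ (fun α : Fin d → Fin n => α j)]
    simp [key, pow_succ, mul_comm]

theorem IsStochastic.sum_plane_snoc {e n k : ℕ} {A : MDMatrix (e + 1) n}
    (hA : IsStochastic k A) (t : ℕ) (F : Finset (Fin e)) (f : Fin e → Fin n) (x : Fin n)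
    (hF : F.card + 1 + t = e + 1 - k) :
    ∑ α ∈ Finset.univ.filter (fun α : Fin e → Fin n => ∀ i ∈ F, α i = f i),
      A (Fin.snoc α x) = (n : ℝ) ^ t := by
  rw [← hA.sum_plane t (insert (Fin.last e) (F.map Fin.castSuccEmb)) (Fin.snoc f x)
    (by rw [Finset.card_insert_of_notMem (by simp), Finset.card_map, hF])]
  refine Finset.sum_nbij' (fun α => Fin.snoc α x) (fun α => Fin.init α) ?_ ?_ ?_ ?_ ?_
  · intro α hα
    simpa using hα
  · intro α hα
    simp only [Finset.mem_filter, Finset.mem_univ, true_and, Finset.forall_mem_insert,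
      Finset.forall_mem_map, Fin.coe_castSuccEmb, Fin.snoc_castSucc] at hα ⊢
    exact hα.2
  · intro α _
    simp
  · intro α hα
    simp only [Finset.mem_filter, Finset.mem_univ, true_and, Finset.forall_mem_insert,
      Fin.snoc_last] at hα
    rw [← hα.1, Fin.snoc_init_self]
  · intro α _
    rfl

theorem IsStochastic.sum_plane_cons {e n k : ℕ} {A : MDMatrix (e + 1) n}
    (hA : IsStochastic k A) (t : ℕ) (F : Finset (Fin e)) (f : Fin e → Fin n) (x : Fin n)
    (hF : F.card + 1 + t = e + 1 - k) :
    ∑ α ∈ Finset.univ.filter (fun α : Fin e → Fin n => ∀ i ∈ F, α i = f i),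
      A (Fin.cons x α) = (n : ℝ) ^ t := by
  rw [← hA.sum_plane t (insert 0 (F.map (Fin.succEmb e))) (Fin.cons x f)
    (by rw [Finset.card_insert_of_notMem (by simp), Finset.card_map, hF])]
  refine Finset.sum_nbij' (fun α => Fin.cons x α) (fun α => Fin.tail α) ?_ ?_ ?_ ?_ ?_
  · intro α hα
    simpa using hα
  · intro α hα
    simp only [Finset.mem_filter, Finset.mem_univ, true_and, Finset.forall_mem_insert,
      Finset.forall_mem_map, Fin.coe_succEmb, Fin.cons_succ] at hα ⊢
    exact hα.2
  · intro α _
    simp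
  · intro α hα
    simp only [Finset.mem_filter, Finset.mem_univ, true_and, Finset.forall_mem_insert,
      Fin.cons_zero] at hα
    rw [← hα.1, Fin.cons_self_tail]
  · intro α _
    rfl

theorem card_eq_card_castAdd_add_card_natAdd {e1 e2 : ℕ} (F : Finset (Fin (e1 + e2))) :
    F.card = (Finset.univ.filter fun i : Fin e1 => Fin.castAdd e2 i ∈ F).card +
      (Finset.univ.filter fun i : Fin e2 => Fin.natAdd e1 i ∈ F).card := by
  simp only [Finset.card_filter]
  rw [← Fin.sum_univ_add (fun i => if i ∈ F then 1 else 0)]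
  simp

/-- A sum of dot product entries over a plane factors along the two blocks of indices. -/
theorem sum_plane_dot {e1 e2 n : ℕ} (A : MDMatrix (e1 + 1) n) (B : MDMatrix (e2 + 1) n)
    (F : Finset (Fin (e1 + e2))) (f : Fin (e1 + e2) → Fin n) :
    ∑ γ ∈ Finset.univ.filter (fun γ : Fin (e1 + e2) → Fin n => ∀ i ∈ F, γ i = f i), dot A B γ =
      ∑ x : Fin n,
        (∑ α ∈ Finset.univ.filter (fun α : Fin e1 → Fin n =>
          ∀ i ∈ Finset.univ.filter (fun i => Fin.castAdd e2 i ∈ F), α i = f (Fin.castAdd e2 i)),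
          A (Fin.snoc α x)) *
        (∑ β ∈ Finset.univ.filter (fun β : Fin e2 → Fin n =>
          ∀ i ∈ Finset.univ.filter (fun i => Fin.natAdd e1 i ∈ F), β i = f (Fin.natAdd e1 i)),
          B (Fin.cons x β)) := by
  unfold dot
  rw [Finset.sum_comm]
  refine Finset.sum_congr rfl fun x _ => ?_
  rw [Finset.sum_mul_sum, ← Finset.sum_product']
  refine Finset.sum_nbij' (fun γ => (fun i => γ (Fin.castAdd e2 i), fun i => γ (Fin.natAdd e1 i)))
    (fun p => Fin.append p.1 p.2) ?_ ?_ ?_ ?_ ?_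
  · intro γ hγ
    simp only [Finset.mem_filter, Finset.mem_univ, true_and, Finset.mem_product] at hγ ⊢
    exact ⟨fun i hi => hγ _ hi, fun i hi => hγ _ hi⟩
  · rintro ⟨α, β⟩ h
    simp only [Finset.mem_filter, Finset.mem_univ, true_and, Finset.mem_product] at h ⊢
    intro i
    refine Fin.addCases (fun i hi => ?_) (fun i hi => ?_) i
    · rw [Fin.append_left, h.1 i hi]
    · rw [Fin.append_right, h.2 i hi]
  · intro γ _
    exact Fin.append_castAdd_natAdd
  · rintro ⟨α, β⟩ _
    simp
  · intro γ _
    rfl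

end MDMatrix

open MDMatrix in
/-- dot product of stochastic matrices (here `d1 = e1 + 1`, `d2 = e2 + 1`):
if `r = max (k1 + d2) (k2 + d1) ≤ d1 + d2 - 2`, then `n^(k1+k2-r-1) • (AB)` is an
`r`-stochastic `(d1+d2-2)`-dimensional matrix. -/
theorem dot_product_stochastic {e1 e2 k1 k2 n : ℕ}
    (A : MDMatrix (e1 + 1) n) (B : MDMatrix (e2 + 1) n)
    (hk1 : 1 ≤ k1) (hk1d : k1 ≤ e1 + 1) (hk2 : 1 ≤ k2) (hk2d : k2 ≤ e2 + 1)
    (hA : IsStochastic k1 A) (hB : IsStochastic k2 B)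
    (hr : max (k1 + (e2 + 1)) (k2 + (e1 + 1)) ≤ e1 + e2) :
    IsStochastic (max (k1 + (e2 + 1)) (k2 + (e1 + 1)))
      (fun γ => (n : ℝ) ^ ((k1 : ℤ) + (k2 : ℤ) -
          (max (k1 + (e2 + 1)) (k2 + (e1 + 1)) : ℤ) - 1) * dot A B γ) := by
  refine ⟨fun γ => mul_nonneg (by positivity)
    (Finset.sum_nonneg fun i _ => mul_nonneg (hA.1 _) (hB.1 _)), fun F hF f => ?_⟩
  have hn : (n : ℝ) ≠ 0 := by
    have := (f ⟨0, by omega⟩).pos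
    positivity
  have hcard := card_eq_card_castAdd_add_card_natAdd F
  rw [← Finset.mul_sum, sum_plane_dot]
  set F1 := Finset.univ.filter fun i : Fin e1 => Fin.castAdd e2 i ∈ F
  set F2 := Finset.univ.filter fun i : Fin e2 => Fin.natAdd e1 i ∈ F
  obtain ⟨s, hs⟩ : ∃ s, F1.card + 1 + s = e1 + 1 - k1 := Nat.exists_eq_add_of_le (by omega) |>.imp
    fun _ h => h.symm
  obtain ⟨t, ht⟩ : ∃ t, F2.card + 1 + t = e2 + 1 - k2 := Nat.exists_eq_add_of_le (by omega) |>.imp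
    fun _ h => h.symm
  simp only [hA.sum_plane_snoc s F1 (fun i => f (Fin.castAdd e2 i)) _ hs,
    hB.sum_plane_cons t F2 (fun i => f (Fin.natAdd e1 i)) _ ht, Finset.sum_const,
    Finset.card_univ, Fintype.card_fin, nsmul_eq_mul]
  have hexp : (k1 : ℤ) + (k2 : ℤ) - (max (k1 + (e2 + 1)) (k2 + (e1 + 1)) : ℤ) - 1 =
      -((1 + (s + t) : ℕ) : ℤ) := by
    omega
  rw [hexp, zpow_neg, zpow_natCast, pow_add, pow_one, pow_add]
  exact inv_mul_cancel₀ (by positivity)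
end

section
/- Let A be a nonnegative d1-dimensional matrix of order n (d1 ≥ 2) and B be a nonnegative d2-dimensional matrix of order n (d2 ≥ 2). Then per(A ∘ B) ≥ per A · (per B)^{d1 − 1}. -/
open scoped BigOperators

namespace MDMatrix

/-- The permanent of a matrix whose dimension is a successor, with indices written by `Fin.cons`. -/
theorem per_succ {d n : ℕ} (A : MDMatrix (d + 1) n) :
    per A = ∑ σ : Fin d → Equiv.Perm (Fin n), ∏ i : Fin n,
      A (Fin.cons i fun m => σ m i) := by
  unfold per
  refine Finset.sum_congr rfl fun σ _ => Finset.prod_congr rfl fun i _ => ?_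
  congr 1
  funext k
  refine Fin.cases ?_ (fun m => ?_) k
  · simp
  · simp only [Fin.val_succ, Nat.add_eq_zero_iff, one_ne_zero, and_false, dite_false, Fin.cons_succ]
    rfl

/-- The permanent is unchanged when the hyperplanes in the first direction are permuted. -/
theorem sum_prod_perm_eq_per {d n : ℕ} (B : MDMatrix (d + 1) n) (τ : Equiv.Perm (Fin n)) :
    ∑ σ : Fin d → Equiv.Perm (Fin n), ∏ i : Fin n, B (Fin.cons (τ i) fun m => σ m i) = per B := by
  rw [per_succ]
  refine Fintype.sum_equiv (Equiv.piCongrRight fun _ => Equiv.mulRight τ⁻¹) _ _ fun σ => ?_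
  refine Fintype.prod_equiv τ _ _ fun i => ?_
  simp

/-- The sum over families of permutations indexed by `Fin (e1 * e2)` factors into `e1` permanents. -/
theorem sum_prod_blocks_eq_per_pow {e1 e2 n : ℕ} (B : MDMatrix (e2 + 1) n)
    (τ : Fin e1 → Equiv.Perm (Fin n)) :
    ∑ σ : Fin (e1 * e2) → Equiv.Perm (Fin n), ∏ i : Fin n, ∏ k : Fin e1,
      B (Fin.cons (τ k i) fun m => σ (finProdFinEquiv (k, m)) i) = per B ^ e1 := by
  calc
    _ = ∑ ρ : Fin e1 → Fin e2 → Equiv.Perm (Fin n), ∏ k : Fin e1, ∏ i : Fin n,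
          B (Fin.cons (τ k i) fun m => ρ k m i) := by
      refine Fintype.sum_equiv
        ((Equiv.arrowCongr finProdFinEquiv.symm (Equiv.refl _)).trans
          (Equiv.curry (Fin e1) (Fin e2) (Equiv.Perm (Fin n)))) _ _ fun σ => ?_
      rw [Finset.prod_comm]
      rfl
    _ = ∏ k : Fin e1, ∑ ρ : Fin e2 → Equiv.Perm (Fin n), ∏ i : Fin n,
          B (Fin.cons (τ k i) fun m => ρ m i) := by
      rw [Finset.prod_univ_sum, Fintype.piFinset_univ]
    _ = per B ^ e1 := by simp [sum_prod_perm_eq_per]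

/-- For a nonnegative function, the product over `i` of the sums over all tuples dominates the sum
over tuples of permutations. -/
theorem sum_perm_prod_le_prod_sum {e n : ℕ} (f : Fin n → (Fin e → Fin n) → ℝ)
    (hf : ∀ i j, 0 ≤ f i j) :
    ∑ τ : Fin e → Equiv.Perm (Fin n), ∏ i, f i (fun k => τ k i) ≤ ∏ i, ∑ j, f i j := by
  rw [Finset.prod_univ_sum, Fintype.piFinset_univ]
  let φ : (Fin e → Equiv.Perm (Fin n)) → Fin n → Fin e → Fin n := fun τ i k => τ k i
  have hφ : Function.Injective φ := fun τ τ' h =>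
    funext fun k => Equiv.ext fun i => congrFun (congrFun h i) k
  calc
    _ = ∑ p ∈ Finset.univ.map ⟨φ, hφ⟩, ∏ i, f i (p i) := by rw [Finset.sum_map]; rfl
    _ ≤ _ := Finset.sum_le_sum_of_subset_of_nonneg (Finset.subset_univ _)
      fun p _ _ => Finset.prod_nonneg fun i _ => hf i (p i)

end MDMatrix

open MDMatrix in
/-- for nonnegative matrices `A` (dimension `d1 = e1 + 1 ≥ 2`) and `B`
(dimension `d2 = e2 + 1 ≥ 2`) of order `n`, `per (A ∘ B) ≥ per A * (per B)^(d1-1)`. -/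
theorem per_circle_product_ge {e1 e2 n : ℕ} (he1 : 1 ≤ e1) (he2 : 1 ≤ e2)
    (A : MDMatrix (e1 + 1) n) (B : MDMatrix (e2 + 1) n)
    (hA : Nonneg A) (hB : Nonneg B) :
    per (circ A B) ≥ per A * per B ^ e1 := by
  calc
    per A * per B ^ e1 = ∑ τ : Fin e1 → Equiv.Perm (Fin n),
        ∑ σ : Fin (e1 * e2) → Equiv.Perm (Fin n), ∏ i : Fin n,
          (A (Fin.cons i fun k => τ k i) *
            ∏ k : Fin e1, B (Fin.cons (τ k i) fun m => σ (finProdFinEquiv (k, m)) i)) := by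
      rw [per_succ A, Finset.sum_mul]
      refine Finset.sum_congr rfl fun τ _ => ?_
      rw [← sum_prod_blocks_eq_per_pow B τ, Finset.mul_sum]
      exact Finset.sum_congr rfl fun σ _ => Finset.prod_mul_distrib.symm
    _ = ∑ σ : Fin (e1 * e2) → Equiv.Perm (Fin n), ∑ τ : Fin e1 → Equiv.Perm (Fin n),
          ∏ i : Fin n, (A (Fin.cons i fun k => τ k i) *
            ∏ k : Fin e1, B (Fin.cons (τ k i) fun m => σ (finProdFinEquiv (k, m)) i)) :=
      Finset.sum_comm
    _ ≤ per (circ A B) := by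
      rw [per_succ (circ A B)]
      refine Finset.sum_le_sum fun σ _ => ?_
      exact sum_perm_prod_le_prod_sum
        (fun i j => A (Fin.cons i j) *
          ∏ k : Fin e1, B (Fin.cons (j k) fun m => σ (finProdFinEquiv (k, m)) i))
        fun i j => mul_nonneg (hA _) (Finset.prod_nonneg fun k _ => hB _)
end
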